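/- Let G be a reductive group over a field k acting on a rational representation V with w ∈ V(k) such that U = Gw is open and G_w is reductive. Then U is an affine variety, isomorphic to the geometric quotient G/G_w. -/

import Mathlib

/-!
STATEMENT 17: Let `G = Spec R` be a reductive group over a field `k` acting on a rational
representation `V = kⁿ` via the coaction `ρ`, with `w ∈ V(k)` such that `U = Gw` is open
and the stabilizer `G_w` (the Hopf quotient `π : R → S`) is reductive.  Then `U` is an
affine variety, isomorphic to the geometric quotient `G/G_w = Spec (R^{G_w})`.
-/

open TensorProduct AlgebraicGeometry CategoryTheory TopologicalSpace

section Framework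

variable {k : Type} [Field k] {R : Type} [CommRing R] [HopfAlgebra k R]

/-- `ρ : V →ₗ V ⊗ R` is a (right) comodule structure over the Hopf algebra `R`, i.e. a
rational representation of the affine group scheme `G = Spec R` on `V`. -/
def IsCoaction {V : Type} [AddCommGroup V] [Module k V] (ρ : V →ₗ[k] V ⊗[k] R) : Prop :=
  (∀ v, (TensorProduct.rid k V)
      ((TensorProduct.map LinearMap.id (Coalgebra.counit (R := k) (A := R))) (ρ v)) = v) ∧
  (∀ v, (TensorProduct.assoc k V R R)
      ((TensorProduct.map ρ (LinearMap.id : R →ₗ[k] R)) (ρ v)) =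
    (TensorProduct.map LinearMap.id (Coalgebra.comul (R := k) (A := R))) (ρ v))

variable {n : ℕ}

/-- The matrix coefficient: the regular function `g ↦ (g • v)_i` on `G = Spec R`. -/
noncomputable def matCoef (ρ : (Fin n → k) →ₗ[k] (Fin n → k) ⊗[k] R)
    (v : Fin n → k) (i : Fin n) : R :=
  (TensorProduct.lid k R) ((TensorProduct.map (LinearMap.proj i) LinearMap.id) (ρ v))

/-- The comorphism `k[V] → R` of the orbit map `G → V`, `g ↦ g • w`. -/
noncomputable def orbitHom (ρ : (Fin n → k) →ₗ[k] (Fin n → k) ⊗[k] R) (w : Fin n → k) :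
    MvPolynomial (Fin n) k →ₐ[k] R :=
  MvPolynomial.aeval (fun i => matCoef ρ w i)

/-- The orbit map `G = Spec R ⟶ V = Spec k[x₁,…,xₙ]` of the point `w`; its set-theoretic
image is the orbit `Gw`. -/
noncomputable def orbitMap (ρ : (Fin n → k) →ₗ[k] (Fin n → k) ⊗[k] R) (w : Fin n → k) :
    Spec (CommRingCat.of R) ⟶ Spec (CommRingCat.of (MvPolynomial (Fin n) k)) :=
  Spec.map (CommRingCat.ofHom (orbitHom ρ w).toRingHom)

/-- The ideal of the scheme-theoretic stabilizer `G_w` of `w` in `G = Spec R`: it is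
generated by the functions `g ↦ (g • w)_i − w_i`, so `G_w = Spec (R ⧸ stabIdeal ρ w)`. -/
noncomputable def stabIdeal (ρ : (Fin n → k) →ₗ[k] (Fin n → k) ⊗[k] R) (w : Fin n → k) :
    Ideal R :=
  Ideal.span {x | ∃ i, x = matCoef ρ w i - algebraMap k R (w i)}

/-- The action of a `k`-rational point `g : R →ₐ[k] k` of `G` on `V = kⁿ`. -/
noncomputable def ptAct (ρ : (Fin n → k) →ₗ[k] (Fin n → k) ⊗[k] R)
    (g : R →ₐ[k] k) (v : Fin n → k) : Fin n → k :=
  (TensorProduct.rid k (Fin n → k)) ((TensorProduct.map LinearMap.id g.toLinearMap) (ρ v))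

/-- The induced coaction of `R` on the coordinate ring `k[V] = k[x₁,…,xₙ]`, i.e. the
comorphism of the action morphism `V × G → V`. -/
noncomputable def coactPoly (ρ : (Fin n → k) →ₗ[k] (Fin n → k) ⊗[k] R) :
    MvPolynomial (Fin n) k →ₐ[k] (MvPolynomial (Fin n) k) ⊗[k] R :=
  MvPolynomial.aeval (fun i => ∑ j, (MvPolynomial.X j) ⊗ₜ[k] (matCoef ρ (Pi.single j 1) i))

/-- The `k`-rational point of affine `n`-space corresponding to `x : kⁿ`. -/
noncomputable def ratPoint (x : Fin n → k) :
    Spec (CommRingCat.of (MvPolynomial (Fin n) k)) :=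
  ⟨RingHom.ker (MvPolynomial.eval x), RingHom.ker_isPrime _⟩

/-- An affine group scheme `G = Spec R` over `k`, given by a finitely generated
commutative Hopf algebra `R`, is reductive: it is smooth over `k` and geometrically
reductive in the sense of Mumford–Haboush (for every finite-dimensional rational
representation and every nonzero invariant vector `w` there is a nonconstant homogeneous
invariant polynomial not vanishing at `w`); by Haboush's theorem geometric reductivity is
equivalent to reductivity. -/
def IsReductive (k R : Type) [Field k] [CommRing R] [HopfAlgebra k R] : Prop :=
  Algebra.FiniteType k R ∧ Algebra.Smooth k R ∧
  ∀ (n : ℕ) (ρ : (Fin n → k) →ₗ[k] (Fin n → k) ⊗[k] R), IsCoaction ρ →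
    ∀ w : Fin n → k, w ≠ 0 → ρ w = w ⊗ₜ[k] (1 : R) →
      ∃ (f : MvPolynomial (Fin n) k) (d : ℕ), 0 < d ∧ f.IsHomogeneous d ∧
        coactPoly ρ f = f ⊗ₜ[k] (1 : R) ∧ MvPolynomial.eval w f ≠ 0

/-- `π : R → S` presents `Spec S` as a closed subgroup scheme of `Spec R`: it is a
surjective algebra map compatible with the comultiplications (a Hopf algebra quotient). -/
def IsHopfQuotient {S : Type} [CommRing S] [HopfAlgebra k S] (π : R →ₐ[k] S) : Prop :=
  Function.Surjective π ∧
    ∀ x : R, Coalgebra.comul (R := k) (π x) =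
      (TensorProduct.map π.toLinearMap π.toLinearMap) (Coalgebra.comul (R := k) x)

end Framework

/-- The subalgebra `R^H` of invariants of `R` under the (right translation) action of the
subgroup scheme `H = Spec S` of `Spec R`, where `π : R → S` is the quotient map of
coordinate rings: those `r` with `(id ⊗ π)(comul r) = r ⊗ 1`. -/
noncomputable def invariantSubalgebra {k : Type} [Field k] {R S : Type} [CommRing R]
    [HopfAlgebra k R] [CommRing S] [HopfAlgebra k S] (π : R →ₐ[k] S) : Subalgebra k R :=
  AlgHom.equalizer
    ((Algebra.TensorProduct.map (AlgHom.id k R) π).comp (Bialgebra.comulAlgHom k R))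
    Algebra.TensorProduct.includeLeft

/-! ### Convolution groups and matrix coefficients -/

section Matrices

open WithConv

variable {k : Type} [Field k] {R : Type} [CommRing R] [HopfAlgebra k R] {n : ℕ}

/-- A matrix over a Hopf algebra `R` whose entries multiply like the matrix coefficients of a
representation of `Spec R`. -/
structure IsMultiplicative (k : Type) [Field k] {R : Type} [CommRing R] [HopfAlgebra k R] {n : ℕ}
    (a : Matrix (Fin n) (Fin n) R) : Prop where
  comul : ∀ i j, Coalgebra.comul (R := k) (a i j) = ∑ l, a i l ⊗ₜ[k] a l j
  counit : ∀ i j, Coalgebra.counit (R := k) (a i j) = (1 : Matrix (Fin n) (Fin n) k) i j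

theorem AlgHom.convMul_apply_of_comul_eq {T : Type} [CommRing T] [Algebra k T]
    (g h : WithConv (R →ₐ[k] T)) {x : R} {ι : Type} [Fintype ι] {y z : ι → R}
    (hx : Coalgebra.comul (R := k) x = ∑ l, y l ⊗ₜ[k] z l) :
    (g * h) x = ∑ l, g (y l) * h (z l) := by
  rw [AlgHom.convMul_apply, hx]
  simp

/-- The inverse of a point of an affine group scheme with values in an algebra `T`. -/
noncomputable def pointInv {T : Type} [CommRing T] [Algebra k T] (g : WithConv (R →ₐ[k] T)) :
    WithConv (R →ₐ[k] T) :=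
  toConv (g.ofConv.comp (HopfAlgebra.antipodeAlgHom k R))

theorem pointInv_mul {T : Type} [CommRing T] [Algebra k T] (g : WithConv (R →ₐ[k] T)) :
    pointInv g * g = 1 := by
  have h := AlgHom.comp_convMul_distrib g.ofConv
    (toConv (HopfAlgebra.antipodeAlgHom k R)) (toConv (AlgHom.id k R))
  rw [AlgHom.antipode_id_cancel] at h
  apply ofConv_injective
  exact h.symm.trans (by ext; simp [AlgHom.convOne_def])

theorem mul_pointInv {T : Type} [CommRing T] [Algebra k T] (g : WithConv (R →ₐ[k] T)) :
    g * pointInv g = 1 := by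
  have h := AlgHom.comp_convMul_distrib g.ofConv
    (toConv (AlgHom.id k R)) (toConv (HopfAlgebra.antipodeAlgHom k R))
  rw [mul_eq_one_comm.mp AlgHom.antipode_id_cancel] at h
  apply ofConv_injective
  exact h.symm.trans (by ext; simp [AlgHom.convOne_def])

theorem toConv_includeLeft_mul {C : Type} [CommRing C] [Algebra k C] (χ : R →ₐ[k] C) :
    toConv (Algebra.TensorProduct.includeLeft : R →ₐ[k] R ⊗[k] C) *
      toConv (Algebra.TensorProduct.includeRight.comp χ) =
    toConv ((Algebra.TensorProduct.map (AlgHom.id k R) χ).comp (Bialgebra.comulAlgHom k R)) := by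
  rw [AlgHom.convMul_def]
  congr 1
  rw [← AlgHom.comp_assoc]
  congr 1
  ext <;> simp

namespace IsMultiplicative

variable {a : Matrix (Fin n) (Fin n) R} {T : Type} [CommRing T] [Algebra k T]

theorem map_mul (ha : IsMultiplicative k a) (g h : WithConv (R →ₐ[k] T)) :
    a.map (g * h) = a.map g * a.map h := by
  ext i j
  simp [Matrix.mul_apply, AlgHom.convMul_apply_of_comul_eq g h (ha.comul i j)]

theorem map_one (ha : IsMultiplicative k a) : a.map (1 : WithConv (R →ₐ[k] T)) = 1 := by
  ext i j
  by_cases h : i = j <;> simp [ha.counit, Matrix.one_apply, h]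

theorem map_pointInv_mul (ha : IsMultiplicative k a) (g : WithConv (R →ₐ[k] T)) :
    a.map (pointInv g) * a.map g = 1 := by
  rw [← ha.map_mul, pointInv_mul, ha.map_one]

theorem map_mul_pointInv (ha : IsMultiplicative k a) (g : WithConv (R →ₐ[k] T)) :
    a.map g * a.map (pointInv g) = 1 := by
  rw [← ha.map_mul, mul_pointInv, ha.map_one]

end IsMultiplicative

end Matrices


/-! ### The matrix of a representation -/

section Representations

open WithConv Matrix

variable {k : Type} [Field k] {R : Type} [CommRing R] [HopfAlgebra k R] {n : ℕ}

/-- The matrix coefficients of a representation with respect to the standard basis. -/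
noncomputable def repMatrix (ρ : (Fin n → k) →ₗ[k] (Fin n → k) ⊗[k] R) :
    Matrix (Fin n) (Fin n) R :=
  fun i j => matCoef ρ (Pi.single j 1) i

theorem tensor_pi_eq_sum {W : Type} [AddCommGroup W] [Module k W] (x : (Fin n → k) ⊗[k] W) :
    x = ∑ i, Pi.single i 1 ⊗ₜ[k]
      (TensorProduct.lid k W) ((TensorProduct.map (LinearMap.proj i) LinearMap.id) x) := by
  induction x with
  | zero => simp
  | add x y hx hy =>
    simp only [map_add, TensorProduct.tmul_add, Finset.sum_add_distrib]
    rw [← hx, ← hy]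
  | tmul v y =>
    simp only [TensorProduct.map_tmul, LinearMap.proj_apply, LinearMap.id_apply,
      TensorProduct.lid_tmul, ← TensorProduct.smul_tmul, ← TensorProduct.sum_tmul]
    congr 1
    ext i
    simp [Finset.sum_apply, Pi.single_apply]

theorem coaction_eq_sum (ρ : (Fin n → k) →ₗ[k] (Fin n → k) ⊗[k] R) (v : Fin n → k) :
    ρ v = ∑ i, Pi.single i 1 ⊗ₜ[k] matCoef ρ v i :=
  tensor_pi_eq_sum (ρ v)

theorem matCoef_eq_sum (ρ : (Fin n → k) →ₗ[k] (Fin n → k) ⊗[k] R) (v : Fin n → k) (i : Fin n) :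
    matCoef ρ v i = ∑ j, v j • repMatrix ρ i j := by
  conv_lhs => rw [← (Pi.basisFun k (Fin n)).sum_repr v]
  simp [matCoef, repMatrix]

variable {ρ : (Fin n → k) →ₗ[k] (Fin n → k) ⊗[k] R}

theorem IsCoaction.comul_matCoef (hρ : IsCoaction ρ) (v : Fin n → k) (i : Fin n) :
    Coalgebra.comul (R := k) (matCoef ρ v i) =
      ∑ l, repMatrix ρ i l ⊗ₜ[k] matCoef ρ v l := by
  have h := congrArg (fun x => (TensorProduct.lid k (R ⊗[k] R))
    ((TensorProduct.map (LinearMap.proj i) LinearMap.id) x)) (hρ.2 v)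
  simp only [coaction_eq_sum ρ v, map_sum, TensorProduct.map_tmul, LinearMap.id_apply] at h
  simp only [coaction_eq_sum ρ (Pi.single _ 1), TensorProduct.sum_tmul, map_sum,
    TensorProduct.assoc_tmul, TensorProduct.map_tmul, LinearMap.proj_apply, LinearMap.id_apply,
    TensorProduct.lid_tmul, Pi.single_apply, ite_smul, one_smul, zero_smul,
    Finset.sum_ite_eq, Finset.mem_univ, if_true] at h
  exact h.symm

theorem IsCoaction.counit_matCoef (hρ : IsCoaction ρ) (v : Fin n → k) (i : Fin n) :
    Coalgebra.counit (R := k) (matCoef ρ v i) = v i := by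
  have h := congrFun (hρ.1 v) i
  simp only [coaction_eq_sum ρ v, map_sum, TensorProduct.map_tmul, LinearMap.id_apply,
    TensorProduct.rid_tmul, Finset.sum_apply, Pi.smul_apply, Pi.single_apply, smul_eq_mul,
    mul_ite, mul_one, mul_zero, Finset.sum_ite_eq, Finset.mem_univ, if_true] at h
  exact h

theorem IsCoaction.isMultiplicative (hρ : IsCoaction ρ) :
    IsMultiplicative k (repMatrix ρ) where
  comul i j := hρ.comul_matCoef _ i
  counit i j := by
    rw [repMatrix, hρ.counit_matCoef]
    simp [Pi.single_apply, Matrix.one_apply]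

theorem map_matCoef {T : Type} [CommRing T] [Algebra k T] (g : R →ₐ[k] T) (w : Fin n → k) :
    (fun i => g (matCoef ρ w i)) = (repMatrix ρ).map g *ᵥ fun j => algebraMap k T (w j) := by
  ext i
  simp [matCoef_eq_sum, Matrix.mulVec, dotProduct, Algebra.smul_def, mul_comm]

/-- The representation with prescribed matrix coefficients. -/
noncomputable def coactionOfMatrix (a : Matrix (Fin n) (Fin n) R) :
    (Fin n → k) →ₗ[k] (Fin n → k) ⊗[k] R :=
  ∑ i, ∑ j, (TensorProduct.mk k (Fin n → k) R (Pi.single i 1)) ∘ₗ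
    (LinearMap.toSpanSingleton k R (a i j)) ∘ₗ (LinearMap.proj j)

theorem coactionOfMatrix_apply (a : Matrix (Fin n) (Fin n) R) (v : Fin n → k) :
    coactionOfMatrix a v = ∑ i, Pi.single i 1 ⊗ₜ[k] ∑ j, v j • a i j := by
  simp [coactionOfMatrix, TensorProduct.tmul_sum]

theorem matCoef_coactionOfMatrix (a : Matrix (Fin n) (Fin n) R) (v : Fin n → k) (i : Fin n) :
    matCoef (coactionOfMatrix a) v i = ∑ j, v j • a i j := by
  simp [matCoef, coactionOfMatrix_apply, Pi.single_apply, ite_smul]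

theorem repMatrix_coactionOfMatrix (a : Matrix (Fin n) (Fin n) R) :
    repMatrix (coactionOfMatrix (k := k) a) = a := by
  ext i j
  simp [repMatrix, matCoef_coactionOfMatrix, Pi.single_apply, ite_smul]

theorem coactionOfMatrix_single (a : Matrix (Fin n) (Fin n) R) (j : Fin n) :
    coactionOfMatrix a (Pi.single j (1 : k)) = ∑ i, Pi.single i 1 ⊗ₜ[k] a i j := by
  simp [coactionOfMatrix_apply, Pi.single_apply, ite_smul]

theorem IsMultiplicative.isCoaction {a : Matrix (Fin n) (Fin n) R} (ha : IsMultiplicative k a) :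
    IsCoaction (coactionOfMatrix (k := k) a) := by
  refine ⟨fun v => ?_, fun v => ?_⟩
  · ext l
    simp [coactionOfMatrix_apply, ha.counit, Matrix.one_apply, Pi.single_apply]
  · simp only [coactionOfMatrix_apply a v, map_sum, TensorProduct.map_tmul, LinearMap.id_apply,
      TensorProduct.sum_tmul, TensorProduct.assoc_tmul, map_smul, ha.comul,
      coactionOfMatrix_single]
    rw [Finset.sum_comm]
    refine Finset.sum_congr rfl fun i _ => ?_
    simp only [← TensorProduct.tmul_sum]
    congr 1
    simp only [TensorProduct.tmul_sum, TensorProduct.tmul_smul, Finset.smul_sum]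
    exact Finset.sum_comm

end Representations


/-! ### Invariant functions and orbits -/

section Orbits

open WithConv Matrix

variable {k : Type} [Field k] {R : Type} [CommRing R] [HopfAlgebra k R] {n : ℕ}
  {ρ : (Fin n → k) →ₗ[k] (Fin n → k) ⊗[k] R} {w : Fin n → k}
  {S : Type} [CommRing S] [HopfAlgebra k S] {π : R →ₐ[k] S}

theorem orbitHom_X (i : Fin n) : orbitHom ρ w (MvPolynomial.X i) = matCoef ρ w i := by
  simp [orbitHom]

theorem mem_invariantSubalgebra {b : R} : b ∈ invariantSubalgebra π ↔
    (Algebra.TensorProduct.map (AlgHom.id k R) π) (Coalgebra.comul (R := k) b) = b ⊗ₜ[k] 1 :=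
  Iff.rfl

theorem apply_matCoef_of_mem_stabilizer (hker : RingHom.ker π.toRingHom = stabIdeal ρ w)
    (i : Fin n) : π (matCoef ρ w i) = algebraMap k S (w i) := by
  have h : matCoef ρ w i - algebraMap k R (w i) ∈ RingHom.ker π.toRingHom :=
    hker ▸ Ideal.subset_span ⟨i, rfl⟩
  have h' : π (matCoef ρ w i - algebraMap k R (w i)) = 0 := h
  simpa [sub_eq_zero] using h'

theorem orbitHom_mem_invariantSubalgebra (hρ : IsCoaction ρ)
    (hker : RingHom.ker π.toRingHom = stabIdeal ρ w) (p : MvPolynomial (Fin n) k) :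
    orbitHom ρ w p ∈ invariantSubalgebra π := by
  induction p using MvPolynomial.induction_on with
  | C a =>
    rw [← MvPolynomial.algebraMap_eq, AlgHom.commutes]
    exact Subalgebra.algebraMap_mem _ a
  | add p q hp hq => rw [map_add]; exact add_mem hp hq
  | mul_X p i hp =>
    rw [map_mul]
    refine mul_mem hp ?_
    rw [orbitHom_X, mem_invariantSubalgebra, hρ.comul_matCoef, map_sum, matCoef_eq_sum ρ w i,
      TensorProduct.sum_tmul]
    refine Finset.sum_congr rfl fun l _ => ?_
    rw [Algebra.TensorProduct.map_tmul, apply_matCoef_of_mem_stabilizer hker,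
      Algebra.algebraMap_eq_smul_one, TensorProduct.tmul_smul, TensorProduct.smul_tmul']
    rfl

/-- Two points of `G` in the same fibre of the orbit map differ by a point of the stabilizer, so
invariant functions do not separate them. -/
theorem eq_of_mem_invariantSubalgebra (hρ : IsCoaction ρ) (hπ : Function.Surjective π)
    (hker : RingHom.ker π.toRingHom = stabIdeal ρ w) {T : Type} [CommRing T] [Algebra k T]
    {g h : R →ₐ[k] T} (hgh : g.comp (orbitHom ρ w) = h.comp (orbitHom ρ w)) {b : R}
    (hb : b ∈ invariantSubalgebra π) : g b = h b := by
  have hgh' : (fun i => g (matCoef ρ w i)) = fun i => h (matCoef ρ w i) := by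
    ext i
    simpa [orbitHom_X] using DFunLike.congr_fun hgh (MvPolynomial.X i)
  let d : WithConv (R →ₐ[k] T) := pointInv (toConv g) * toConv h
  have hd : RingHom.ker π.toRingHom ≤ RingHom.ker d.ofConv.toRingHom := by
    rw [hker, stabIdeal, Ideal.span_le]
    rintro _ ⟨i, rfl⟩
    have h1 : (fun i => d.ofConv (matCoef ρ w i)) = fun i => algebraMap k T (w i) := by
      have h2 : (repMatrix ρ).map d.ofConv =
          (repMatrix ρ).map (pointInv (toConv g)) * (repMatrix ρ).map h :=
        hρ.isMultiplicative.map_mul _ _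
      rw [map_matCoef, h2, ← Matrix.mulVec_mulVec, ← map_matCoef, ← hgh', map_matCoef,
        Matrix.mulVec_mulVec]
      erw [hρ.isMultiplicative.map_pointInv_mul (toConv g)]
      rw [Matrix.one_mulVec]
    have h3 := congrFun h1 i
    change d.ofConv _ = 0
    rw [map_sub, h3, AlgHom.commutes, sub_self]
  obtain ⟨d', hd'⟩ : ∃ d' : S →ₐ[k] T, d'.comp π = d.ofConv :=
    ⟨AlgHom.liftOfSurjective π hπ d.ofConv hd, AlgHom.liftOfSurjective_comp _ _ _ _⟩
  have hmul : toConv g * d = toConv h := by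
    rw [← mul_assoc, mul_pointInv, one_mul]
  have key : (Algebra.TensorProduct.lift g d.ofConv (fun _ _ => .all ..)) =
      (Algebra.TensorProduct.lift g d' (fun _ _ => .all ..)).comp
        (Algebra.TensorProduct.map (AlgHom.id k R) π) := by
    rw [← hd']
    ext <;> simp
  have h4 : h b = (toConv g * d) b := by rw [hmul]
  rw [h4, AlgHom.convMul_apply]
  erw [key]
  rw [AlgHom.comp_apply, mem_invariantSubalgebra.mp hb]
  simp

end Orbits


/-! ### Flatness of orbit maps -/

section Flatness

open WithConv Matrix

variable {k : Type} [Field k] {R : Type} [CommRing R] [HopfAlgebra k R] {n : ℕ}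
  {ρ : (Fin n → k) →ₗ[k] (Fin n → k) ⊗[k] R} {w : Fin n → k}
  {C : Type} [CommRing C] [Algebra k C]

theorem comulMap_comp_lift (χ χ' : R →ₐ[k] C)
    (h : (toConv χ : WithConv (R →ₐ[k] C)) * toConv χ' = 1) :
    (Algebra.TensorProduct.lift
      ((Algebra.TensorProduct.map (AlgHom.id k R) χ).comp (Bialgebra.comulAlgHom k R))
      (Algebra.TensorProduct.includeRight : C →ₐ[k] R ⊗[k] C) (fun _ _ => .all ..)).comp
    (Algebra.TensorProduct.lift
      ((Algebra.TensorProduct.map (AlgHom.id k R) χ').comp (Bialgebra.comulAlgHom k R))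
      (Algebra.TensorProduct.includeRight : C →ₐ[k] R ⊗[k] C) (fun _ _ => .all ..)) =
    AlgHom.id k _ := by
  set E := Algebra.TensorProduct.lift
      ((Algebra.TensorProduct.map (AlgHom.id k R) χ).comp (Bialgebra.comulAlgHom k R))
      (Algebra.TensorProduct.includeRight : C →ₐ[k] R ⊗[k] C) (fun _ _ => .all ..) with hE
  have hleft : E.comp Algebra.TensorProduct.includeLeft =
      (Algebra.TensorProduct.map (AlgHom.id k R) χ).comp (Bialgebra.comulAlgHom k R) := by
    ext; simp [hE]
  have hright : E.comp Algebra.TensorProduct.includeRight =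
      Algebra.TensorProduct.includeRight := by
    ext; simp [hE]
  have hinv : toConv ((Algebra.TensorProduct.includeRight : C →ₐ[k] R ⊗[k] C).comp χ) *
      toConv ((Algebra.TensorProduct.includeRight : C →ₐ[k] R ⊗[k] C).comp χ') = 1 := by
    have := AlgHom.comp_convMul_distrib
      (Algebra.TensorProduct.includeRight : C →ₐ[k] R ⊗[k] C) (toConv χ) (toConv χ')
    rw [h] at this
    apply ofConv_injective
    exact this.symm.trans (by ext; simp [AlgHom.convOne_def])
  have hmap : E.comp ((Algebra.TensorProduct.map (AlgHom.id k R) χ').comp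
      (Bialgebra.comulAlgHom k R)) = Algebra.TensorProduct.includeLeft := by
    have h1 := AlgHom.comp_convMul_distrib E
      (toConv (Algebra.TensorProduct.includeLeft : R →ₐ[k] R ⊗[k] C))
      (toConv (Algebra.TensorProduct.includeRight.comp χ'))
    rw [toConv_includeLeft_mul] at h1
    refine h1.trans ?_
    simp only []
    rw [hleft, ← AlgHom.comp_assoc, hright, ← toConv_includeLeft_mul, mul_assoc, hinv, mul_one,
      ofConv_toConv]
  refine Algebra.TensorProduct.ext ?_ ?_
  · rw [AlgHom.comp_assoc, Algebra.TensorProduct.lift_comp_includeLeft]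
    exact hmap
  · ext c
    simp [hE]

/-- The morphism `G × Y ⟶ G`, `(g, y) ↦ g * χ y`, is faithfully flat. -/
theorem faithfullyFlat_comulMap [Nontrivial C] (χ : R →ₐ[k] C) :
    ((Algebra.TensorProduct.map (AlgHom.id k R) χ).comp
      (Bialgebra.comulAlgHom k R)).toRingHom.FaithfullyFlat := by
  let E (χ : R →ₐ[k] C) := Algebra.TensorProduct.lift
      ((Algebra.TensorProduct.map (AlgHom.id k R) χ).comp (Bialgebra.comulAlgHom k R))
      (Algebra.TensorProduct.includeRight : C →ₐ[k] R ⊗[k] C) (fun _ _ => .all ..)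
  have hbij : Function.Bijective (E χ) := by
    refine Function.bijective_iff_has_inverse.mpr ⟨E (pointInv (toConv χ)).ofConv, ?_, ?_⟩
    · exact DFunLike.congr_fun (comulMap_comp_lift _ _ (pointInv_mul (toConv χ)))
    · exact DFunLike.congr_fun (comulMap_comp_lift _ _ (mul_pointInv (toConv χ)))
  have hcomp : ((Algebra.TensorProduct.map (AlgHom.id k R) χ).comp
      (Bialgebra.comulAlgHom k R)).toRingHom =
      (E χ).toRingHom.comp (algebraMap R (R ⊗[k] C)) := by
    ext x
    simp [E, ← Algebra.TensorProduct.one_def]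
  rw [hcomp]
  exact RingHom.FaithfullyFlat.stableUnderComposition _ _
    (RingHom.faithfullyFlat_algebraMap_iff.mpr inferInstance)
    (RingHom.FaithfullyFlat.of_bijective hbij)

/-- The comorphism of the action `G × V ⟶ V`. -/
noncomputable def actionHom (a : Matrix (Fin n) (Fin n) R) :
    MvPolynomial (Fin n) k →ₐ[k] R ⊗[k] MvPolynomial (Fin n) k :=
  MvPolynomial.aeval fun i => ∑ j, a i j ⊗ₜ[k] MvPolynomial.X j

theorem lift_comp_actionHom {a b : Matrix (Fin n) (Fin n) R} (h : a * b = 1) :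
    (Algebra.TensorProduct.lift Algebra.TensorProduct.includeLeft (actionHom (k := k) b)
      (fun _ _ => .all ..)).comp
    (Algebra.TensorProduct.lift Algebra.TensorProduct.includeLeft (actionHom (k := k) a)
      (fun _ _ => .all ..)) = AlgHom.id k _ := by
  refine Algebra.TensorProduct.ext (by ext; simp) ?_
  refine MvPolynomial.algHom_ext fun i => ?_
  have hi (l : Fin n) : ∑ j, a i j * b j l = if i = l then 1 else 0 := by
    rw [← Matrix.mul_apply, h, Matrix.one_apply]
  simp only [AlgHom.comp_apply, AlgHom.restrictScalars_apply,
    Algebra.TensorProduct.includeRight_apply, Algebra.TensorProduct.lift_tmul, map_one, one_mul,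
    actionHom, MvPolynomial.aeval_X, map_sum, Algebra.TensorProduct.includeLeft_apply,
    Finset.mul_sum, Algebra.TensorProduct.tmul_mul_tmul, AlgHom.id_apply]
  rw [Finset.sum_comm]
  simp [← TensorProduct.sum_tmul, hi, TensorProduct.ite_tmul]

theorem flat_actionHom {a b : Matrix (Fin n) (Fin n) R} (hab : a * b = 1) (hba : b * a = 1) :
    (actionHom (k := k) a).toRingHom.Flat := by
  let E (a : Matrix (Fin n) (Fin n) R) :=
    Algebra.TensorProduct.lift
      (Algebra.TensorProduct.includeLeft : R →ₐ[k] R ⊗[k] MvPolynomial (Fin n) k)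
      (actionHom (k := k) a) (fun _ _ => .all ..)
  have hbij : Function.Bijective (E a) := by
    refine Function.bijective_iff_has_inverse.mpr ⟨E b, ?_, ?_⟩
    · exact DFunLike.congr_fun (lift_comp_actionHom hab)
    · exact DFunLike.congr_fun (lift_comp_actionHom hba)
  have hcomp : (actionHom (k := k) a).toRingHom =
      ((E a).toRingHom.comp (Algebra.TensorProduct.comm k _ _).toRingHom).comp
        (algebraMap (MvPolynomial (Fin n) k) (MvPolynomial (Fin n) k ⊗[k] R)) := by
    ext x <;> simp [E, ← Algebra.TensorProduct.one_def]
  rw [hcomp]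
  refine .comp ?_ (.comp (.of_bijective ?_) (.of_bijective hbij))
  · rw [RingHom.flat_algebraMap_iff]
    infer_instance
  · exact (Algebra.TensorProduct.comm k _ _).bijective

theorem RingHom.Flat.of_comp_of_faithfullyFlat {A B D : Type} [CommRing A] [CommRing B]
    [CommRing D] {f : A →+* B} {g : B →+* D} (hgf : (g.comp f).Flat) (hg : g.FaithfullyFlat) :
    f.Flat := by
  algebraize [f, g, g.comp f]
  change Module.Flat A B
  have : Module.Flat A D := hgf
  rw [Module.Flat.iff_lTensor_preserves_injective_linearMap]
  intro N N' _ _ _ _ l hl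
  have h1 := Module.Flat.lTensor_preserves_injective_linearMap (M := D) l hl
  have : Module.FaithfullyFlat B D := hg
  let l' : B ⊗[A] N →ₗ[B] B ⊗[A] N' := AlgebraTensorModule.lTensor B B l
  change Function.Injective l'
  rw [← Module.FaithfullyFlat.lTensor_injective_iff_injective B D]
  let e := AlgebraTensorModule.cancelBaseChange A B B D N
  let e' := AlgebraTensorModule.cancelBaseChange A B B D N'
  have h2 (x : D ⊗[B] (B ⊗[A] N)) : l.lTensor D (e x) = e' (l'.lTensor D x) := by
    induction x with
    | zero => simp
    | add x y hx hy => simp only [map_add, hx, hy]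
    | tmul d y =>
      induction y with
      | zero => simp
      | add x y hx hy => simp only [TensorProduct.tmul_add, map_add, hx, hy]
      | tmul b m => simp [e, e', l']
  intro x y hxy
  apply e.injective
  apply h1
  rw [h2, h2, hxy]

theorem flat_orbitHom_of_point (hρ : IsCoaction ρ) [Nontrivial C] (χ : R →ₐ[k] C)
    (hχ : (χ.comp (orbitHom ρ w)).toRingHom.Flat) : (orbitHom ρ w).toRingHom.Flat := by
  refine RingHom.Flat.of_comp_of_faithfullyFlat ?_ (faithfullyFlat_comulMap χ)
  have hcomp : ((Algebra.TensorProduct.map (AlgHom.id k R) χ).comp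
      (Bialgebra.comulAlgHom k R)).comp (orbitHom ρ w) =
      (Algebra.TensorProduct.map (AlgHom.id k R) (χ.comp (orbitHom ρ w))).comp
        (actionHom (repMatrix ρ)) := by
    refine MvPolynomial.algHom_ext fun i => ?_
    simp [orbitHom_X, actionHom, hρ.comul_matCoef]
  have hflat : (Algebra.TensorProduct.map (AlgHom.id k R) (χ.comp (orbitHom ρ w))).Flat :=
    RingHom.Flat.tensorProductMap (S := k) (RingHom.Flat.id R) hχ
  have h1 := hρ.isMultiplicative.map_mul_pointInv (toConv (AlgHom.id k R))
  have h2 := hρ.isMultiplicative.map_pointInv_mul (toConv (AlgHom.id k R))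
  have h := (flat_actionHom (k := k) h1 h2).comp hflat
  have hcomp' := congrArg AlgHom.toRingHom hcomp
  change (((Algebra.TensorProduct.map (AlgHom.id k R) χ).comp
      (Bialgebra.comulAlgHom k R)).comp (orbitHom ρ w)).toRingHom.Flat
  rw [hcomp']
  exact h

theorem flat_orbitHom (hρ : IsCoaction ρ) (hinj : Function.Injective (orbitHom ρ w)) :
    (orbitHom ρ w).toRingHom.Flat := by
  let A := MvPolynomial (Fin n) k
  let M : Submonoid R := (nonZeroDivisors A).map (orbitHom ρ w)
  let C := Localization M
  have : Nontrivial C := by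
    rw [← not_subsingleton_iff_nontrivial, IsLocalization.subsingleton_iff (M := M)]
    rintro ⟨p, hp, h0⟩
    exact nonZeroDivisors.ne_zero hp (hinj (h0.trans (map_zero _).symm))
  let χ : R →ₐ[k] C := IsScalarTower.toAlgHom k R C
  refine flat_orbitHom_of_point hρ χ ?_
  have hunit (y : nonZeroDivisors A) : IsUnit ((χ.comp (orbitHom ρ w)).toRingHom y) :=
    IsLocalization.map_units C (⟨_, y, y.2, rfl⟩ : M)
  rw [← IsLocalization.lift_comp (S := FractionRing A) hunit]
  exact .comp (RingHom.flat_algebraMap_iff.mpr inferInstance)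
    (.of_isField (Field.toIsField (FractionRing A)) _)

end Flatness

/-! ### Descent of invariants to the orbit -/

section Descent

open WithConv Matrix

variable {k : Type} [Field k] {R : Type} [CommRing R] [HopfAlgebra k R] {n : ℕ}
  {ρ : (Fin n → k) →ₗ[k] (Fin n → k) ⊗[k] R} {w : Fin n → k}
  {S : Type} [CommRing S] [HopfAlgebra k S] {π : R →ₐ[k] S}

theorem mem_range_of_faithfullyFlat (hρ : IsCoaction ρ) (hπ : Function.Surjective π)
    (hker : RingHom.ker π.toRingHom = stabIdeal ρ w) {A' R' : Type} [CommRing A'] [CommRing R']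
    {f : A' →+* R'} (hf : f.FaithfullyFlat) {i : R →+* R'} {j : MvPolynomial (Fin n) k →+* A'}
    (hij : i.comp (orbitHom ρ w).toRingHom = f.comp j) {b : R} (hb : b ∈ invariantSubalgebra π) :
    i b ∈ f.range := by
  algebraize [f]
  have : Module.FaithfullyFlat A' R' := hf
  have hij' (p) : i (orbitHom ρ w p) = algebraMap A' R' (j p) := DFunLike.congr_fun hij p
  let T := R' ⊗[A'] R'
  let : Algebra k T := ((algebraMap A' T).comp (j.comp MvPolynomial.C)).toAlgebra
  have hc (c : k) : i (algebraMap k R c) = algebraMap A' R' (j (MvPolynomial.C c)) := by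
    rw [← hij', ← MvPolynomial.algebraMap_eq, AlgHom.commutes]
  let g : R →ₐ[k] T :=
    { (Algebra.TensorProduct.includeLeftRingHom : R' →+* T).comp i with
      commutes' c := by
        change (Algebra.TensorProduct.includeLeft : R' →ₐ[A'] T) (i (algebraMap k R c)) = _
        rw [hc, AlgHom.commutes]
        rfl }
  let h : R →ₐ[k] T :=
    { (Algebra.TensorProduct.includeRight : R' →ₐ[A'] T).toRingHom.comp i with
      commutes' c := by
        change (Algebra.TensorProduct.includeRight : R' →ₐ[A'] T) (i (algebraMap k R c)) = _
        rw [hc, AlgHom.commutes]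
        rfl }
  have hgh : g.comp (orbitHom ρ w) = h.comp (orbitHom ρ w) := by
    ext1 l
    change (Algebra.TensorProduct.includeLeft : R' →ₐ[A'] T) (i (orbitHom ρ w _)) =
      (Algebra.TensorProduct.includeRight : R' →ₐ[A'] T) (i (orbitHom ρ w _))
    rw [hij', AlgHom.commutes, AlgHom.commutes]
  have key : i b ∈ Algebra.TensorProduct.includeLeftRingHom.eqLocus
      (Algebra.TensorProduct.includeRight : R' →ₐ[A'] T).toRingHom :=
    eq_of_mem_invariantSubalgebra hρ hπ hker hgh hb
  have heff := (Algebra.IsEffective.of_faithfullyFlat A' R').eqLocus_includeLeft_includeRight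
  have := heff.le key
  exact this

theorem awayMap_faithfullyFlat {A B : Type} [CommRing A] [CommRing B] {φ : A →+* B}
    (hφ : φ.Flat) {f : A}
    (hf : (PrimeSpectrum.basicOpen f : Set (PrimeSpectrum A)) ⊆ Set.range (PrimeSpectrum.comap φ)) :
    (Localization.awayMap φ f).FaithfullyFlat := by
  rw [RingHom.FaithfullyFlat.iff_flat_and_comap_surjective]
  refine ⟨RingHom.Flat.isStableUnderBaseChange.localizationPreserves.away _ _ _ _ hφ, fun P => ?_⟩
  have hinj : Function.Injective
      (PrimeSpectrum.comap (algebraMap A (Localization.Away f))) :=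
    PrimeSpectrum.localization_comap_injective _ (Submonoid.powers f)
  have hP : PrimeSpectrum.comap (algebraMap A (Localization.Away f)) P ∈
      (PrimeSpectrum.basicOpen f : Set (PrimeSpectrum A)) := by
    rw [← PrimeSpectrum.localization_away_comap_range (Localization.Away f) f]
    exact ⟨P, rfl⟩
  obtain ⟨q, hq⟩ := hf hP
  have hq' : q ∈ (PrimeSpectrum.basicOpen (φ f) : Set (PrimeSpectrum B)) := by
    rw [← hq] at hP
    exact hP
  rw [← PrimeSpectrum.localization_away_comap_range (Localization.Away (φ f)) (φ f)] at hq'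
  obtain ⟨Q, rfl⟩ := hq'
  refine ⟨Q, hinj ?_⟩
  rw [← hq, ← PrimeSpectrum.comap_comp_apply, ← PrimeSpectrum.comap_comp_apply]
  congr 1
  exact IsLocalization.map_comp _

theorem exists_pow_mul_eq_orbitHom (hρ : IsCoaction ρ) (hπ : Function.Surjective π)
    (hker : RingHom.ker π.toRingHom = stabIdeal ρ w)
    (hflat : (orbitHom ρ w).toRingHom.Flat) {f : MvPolynomial (Fin n) k}
    (hf : (PrimeSpectrum.basicOpen f : Set (PrimeSpectrum (MvPolynomial (Fin n) k))) ⊆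
      Set.range (PrimeSpectrum.comap (orbitHom ρ w).toRingHom))
    {b : R} (hb : b ∈ invariantSubalgebra π) :
    ∃ (m : ℕ) (p : MvPolynomial (Fin n) k), orbitHom ρ w f ^ m * b = orbitHom ρ w p := by
  let φ := (orbitHom ρ w).toRingHom
  have hcomp : (algebraMap R (Localization.Away (φ f))).comp φ =
      (Localization.awayMap φ f).comp (algebraMap _ (Localization.Away f)) :=
    (IsLocalization.map_comp _).symm
  obtain ⟨x, hx⟩ := mem_range_of_faithfullyFlat hρ hπ hker (awayMap_faithfullyFlat hflat hf)
    hcomp hb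
  obtain ⟨⟨p, _, m, rfl⟩, hp⟩ := IsLocalization.surj (Submonoid.powers f) x
  have h := congrArg (Localization.awayMap φ f) hp
  have hc (p) : Localization.awayMap φ f (algebraMap _ _ p) = algebraMap R _ (φ p) :=
    (DFunLike.congr_fun hcomp p).symm
  rw [map_mul, hx, hc, hc, ← map_mul] at h
  obtain ⟨⟨_, l, rfl⟩, hl⟩ := (IsLocalization.eq_iff_exists (Submonoid.powers (φ f)) _).mp h
  refine ⟨l + m, f ^ l * p, ?_⟩
  rw [map_mul, map_pow]
  refine Eq.trans ?_ hl
  change φ f ^ (l + m) * b = φ f ^ l * (b * φ (f ^ m))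
  rw [map_pow]
  ring

theorem orbitHom_injective
    (hU : IsOpen (Set.range (PrimeSpectrum.comap (orbitHom ρ w).toRingHom))) :
    Function.Injective (orbitHom ρ w) := by
  have : Nontrivial R := (Bialgebra.counitAlgHom k R).toRingHom.domain_nontrivial
  obtain ⟨x⟩ : Nonempty (PrimeSpectrum R) := inferInstance
  have hbot : (⊥ : PrimeSpectrum (MvPolynomial (Fin n) k)) ∈
      Set.range (PrimeSpectrum.comap (orbitHom ρ w).toRingHom) :=
    hU.stableUnderGeneralization (PrimeSpectrum.le_iff_specializes _ _ |>.mp bot_le) ⟨x, rfl⟩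
  obtain ⟨q, hq⟩ := hbot
  rw [injective_iff_map_eq_zero]
  intro p hp
  have hp' : p ∈ (PrimeSpectrum.comap (orbitHom ρ w).toRingHom q).asIdeal := by
    change orbitHom ρ w p ∈ q.asIdeal
    rw [hp]
    exact zero_mem _
  rw [hq] at hp'
  exact hp'

end Descent

/-! ### Finite-dimensional pieces of comodules -/

section Comodules

variable {k : Type} [Field k] {S : Type} [CommRing S] [HopfAlgebra k S]
  {M : Type} [AddCommGroup M] [Module k M]

/-- A right comodule of arbitrary dimension. -/
structure IsComodule (δ : M →ₗ[k] M ⊗[k] S) : Prop where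
  coassoc : ∀ x, TensorProduct.assoc k M S S (δ.rTensor S (δ x)) =
    (Coalgebra.comul (R := k) (A := S)).lTensor M (δ x)
  counit : ∀ x, TensorProduct.rid k M
    ((Coalgebra.counit (R := k) (A := S)).lTensor M (δ x)) = x

variable (k S) in
theorem isComodule_comul : IsComodule (Coalgebra.comul (R := k) (A := S)) where
  coassoc := Coalgebra.coassoc_apply
  counit x := by simp

/-- Contraction of the second factor of a tensor product with a functional. -/
noncomputable def rightSlice (M : Type) [AddCommGroup M] [Module k M] (ξ : S →ₗ[k] k) :
    M ⊗[k] S →ₗ[k] M :=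
  (TensorProduct.rid k M).toLinearMap ∘ₗ ξ.lTensor M

@[simp]
theorem rightSlice_tmul (ξ : S →ₗ[k] k) (m : M) (s : S) :
    rightSlice M ξ (m ⊗ₜ s) = ξ s • m := by
  simp [rightSlice]

theorem exists_fg_subcomodule {δ : M →ₗ[k] M ⊗[k] S} (hδ : IsComodule δ) {m : ℕ}
    (r : Fin m → M) : ∃ D : Submodule k S, D.FG ∧
      (∀ i, δ (r i) ∈ LinearMap.range (D.subtype.lTensor M)) ∧
      ∀ d ∈ D, Coalgebra.comul (R := k) d ∈ LinearMap.range (D.subtype.lTensor S) := by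
  classical
  let e := Module.Basis.ofVectorSpace k M
  let E := TensorProduct.equivFinsuppOfBasisLeft (N := S) e
  let D : Submodule k S := Submodule.span k (⋃ i, ((E (δ (r i))).support.image (E (δ (r i))) : Set S))
  have hD (i) (a) : E (δ (r i)) a ∈ D := by
    by_cases h : E (δ (r i)) a = 0
    · rw [h]; exact zero_mem _
    · refine Submodule.subset_span (Set.mem_iUnion.mpr ⟨i, ?_⟩)
      exact Finset.mem_coe.mpr (Finset.mem_image_of_mem _ (Finsupp.mem_support_iff.mpr h))
  have hrange (i) : δ (r i) ∈ LinearMap.range (D.subtype.lTensor M) := by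
    rw [← E.symm_apply_apply (δ (r i)), TensorProduct.equivFinsuppOfBasisLeft_symm_apply]
    exact sum_mem fun a _ => ⟨e a ⊗ₜ ⟨_, hD i a⟩, by simp⟩
  refine ⟨D, Submodule.fg_span (Set.finite_iUnion fun i => Finset.finite_toSet _), hrange, ?_⟩
  intro d hd
  induction hd using Submodule.span_induction with
  | zero => rw [map_zero]; exact zero_mem _
  | add x y _ _ hx hy => rw [map_add]; exact add_mem hx hy
  | smul c x _ hx => rw [map_smul]; exact Submodule.smul_mem _ _ hx
  | mem x hx =>
    obtain ⟨i, hx⟩ := Set.mem_iUnion.mp hx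
    obtain ⟨a, -, rfl⟩ := Finset.mem_image.mp (Finset.mem_coe.mp hx)
    obtain ⟨z, hz⟩ := hrange i
    let c (N : Type) [AddCommGroup N] [Module k N] : M ⊗[k] N →ₗ[k] N :=
      (TensorProduct.lid k N).toLinearMap ∘ₗ (e.coord a).rTensor N
    have h1 : E (δ (r i)) a = c S (δ (r i)) := TensorProduct.equivFinsuppOfBasisLeft_apply ..
    have h2 (y : M ⊗[k] S) : Coalgebra.comul (R := k) (c S y) =
        c (S ⊗[k] S) ((Coalgebra.comul (R := k) (A := S)).lTensor M y) := by
      induction y with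
      | zero => simp
      | add x y hx hy => simp only [map_add, hx, hy]
      | tmul x y => simp [c]
    have h3 (y : (M ⊗[k] S) ⊗[k] S) :
        c (S ⊗[k] S) (TensorProduct.assoc k M S S y) = (c S).rTensor S y := by
      induction y with
      | zero => simp
      | add x y hx hy => simp only [map_add, hx, hy]
      | tmul x y =>
        induction x with
        | zero => simp
        | add x y hx hy => simp only [TensorProduct.add_tmul, map_add, hx, hy]
        | tmul x z => simp [c, TensorProduct.smul_tmul']
    refine ⟨(c S ∘ₗ δ).rTensor D z, ?_⟩
    rw [h1, h2, ← hδ.coassoc, h3, ← hz, ← LinearMap.comp_apply, LinearMap.lTensor_comp_rTensor,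
      ← LinearMap.comp_apply, ← LinearMap.comp_apply, ← LinearMap.rTensor_comp,
      LinearMap.rTensor_comp_lTensor]

theorem eq_sum_rightSlice {D : Submodule k S} {N : ℕ} (b : Module.Basis (Fin N) k D)
    {ξ : Fin N → S →ₗ[k] k} (hξ : ∀ j (d : D), ξ j d = b.repr d j) {x : M ⊗[k] S}
    (hx : x ∈ LinearMap.range (D.subtype.lTensor M)) :
    x = ∑ j, rightSlice M (ξ j) x ⊗ₜ (b j : S) := by
  obtain ⟨y, rfl⟩ := hx
  induction y with
  | zero => simp
  | add x y hx hy =>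
    simp only [map_add, TensorProduct.add_tmul, Finset.sum_add_distrib]
    rw [← hx, ← hy]
  | tmul x d =>
    simp only [LinearMap.lTensor_tmul, Submodule.subtype_apply, rightSlice_tmul, hξ,
      TensorProduct.smul_tmul, ← TensorProduct.tmul_sum]
    congr 1
    have h := congrArg D.subtype (b.sum_repr d)
    rw [map_sum] at h
    exact h.symm

/-- Finitely many elements of a comodule lie in the span of vectors transforming under a
matrix representation. -/
theorem IsComodule.exists_matrix {δ : M →ₗ[k] M ⊗[k] S} (hδ : IsComodule δ) {m : ℕ}
    (r : Fin m → M) : ∃ (N : ℕ) (t : Matrix (Fin N) (Fin N) S) (ξ : Fin N → S →ₗ[k] k)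
      (c : Fin N → k), IsMultiplicative k t ∧
      (∀ i, r i = ∑ j, c j • rightSlice M (ξ j) (δ (r i))) ∧
      ∀ i j, δ (rightSlice M (ξ j) (δ (r i))) =
        ∑ l, rightSlice M (ξ l) (δ (r i)) ⊗ₜ t l j := by
  obtain ⟨D, hfg, hr, hD⟩ := exists_fg_subcomodule hδ r
  have : Module.Finite k D := Module.Finite.iff_fg.mpr hfg
  let b := Module.finBasis k D
  choose ξ hξ using fun j => LinearMap.exists_extend (b.coord j)
  have hξ' (j) (d : D) : ξ j d = b.repr d j := DFunLike.congr_fun (hξ j) d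
  have hδr (i) := eq_sum_rightSlice b hξ' (hr i)
  have hΔ (l) := eq_sum_rightSlice b hξ' (hD _ (b l).2)
  have hbξ (l j) : ξ j (b l) = if l = j then 1 else 0 := by
    rw [hξ', b.repr_self, Finsupp.single_apply]
  let t : Matrix _ _ S := fun l j => rightSlice S (ξ j) (Coalgebra.comul (R := k) (b l : S))
  have key {P : Type} [AddCommGroup P] [Module k P] {γ : P →ₗ[k] P ⊗[k] S} (hγ : IsComodule γ)
      (x : P) (hx : γ x = ∑ j, rightSlice P (ξ j) (γ x) ⊗ₜ (b j : S)) (j) :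
      γ (rightSlice P (ξ j) (γ x)) = ∑ l, rightSlice P (ξ l) (γ x) ⊗ₜ t l j := by
    have h := congrArg (rightSlice (P ⊗[k] S) (ξ j))
      (congrArg (TensorProduct.assoc k P S S).symm (hγ.coassoc x))
    rw [LinearEquiv.symm_apply_apply, hx] at h
    simp only [map_sum, LinearMap.rTensor_tmul, LinearMap.lTensor_tmul, rightSlice_tmul, hbξ,
      ite_smul, one_smul, zero_smul, Finset.sum_ite_eq', Finset.mem_univ, if_true] at h
    refine h.trans (Finset.sum_congr rfl fun l _ => ?_)
    rw [hΔ l]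
    simp [TensorProduct.tmul_sum, hbξ, t]
  refine ⟨_, t, ξ, fun j => Coalgebra.counit (R := k) (b j : S), ⟨fun l j => ?_, fun l j => ?_⟩,
    fun i => ?_, fun i j => ?_⟩
  · exact key (isComodule_comul k S) _ (hΔ l) j
  · have h (x : S ⊗[k] S) : Coalgebra.counit (R := k) (rightSlice S (ξ j) x) =
        ξ j (TensorProduct.lid k S ((Coalgebra.counit (R := k) (A := S)).rTensor S x)) := by
      induction x with
      | zero => simp
      | add x y hx hy => simp only [map_add, hx, hy]
      | tmul x y => simp [mul_comm]
    rw [h, Coalgebra.rTensor_counit_comul, TensorProduct.lid_tmul, one_smul, hbξ,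
      Matrix.one_apply]
  · conv_lhs => rw [← hδ.counit (r i), hδr i]
    simp
  · exact key hδ _ (hδr i) j

end Comodules

/-! ### Geometric reductivity and invariants -/

section Reductivity

open WithConv Matrix

variable {k : Type} [Field k] {R : Type} [CommRing R] [HopfAlgebra k R]
  {S : Type} [CommRing S] [HopfAlgebra k S] {π : R →ₐ[k] S} {n : ℕ}

theorem IsHopfQuotient.counit_apply (hπ : IsHopfQuotient π) (x : R) :
    Coalgebra.counit (R := k) (π x) = Coalgebra.counit (R := k) x := by
  let e : WithConv (R →ₐ[k] k) := toConv ((Bialgebra.counitAlgHom k S).comp π)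
  have hee : e * e = e := by
    apply ofConv_injective
    ext y
    have h := (AlgHom.convMul_apply (toConv (Bialgebra.counitAlgHom k S))
      (toConv (Bialgebra.counitAlgHom k S)) (π y)).symm
    refine (AlgHom.convMul_apply e e y).trans ?_
    have h1 : (toConv (Bialgebra.counitAlgHom k S)) * toConv (Bialgebra.counitAlgHom k S) =
      toConv (Bialgebra.counitAlgHom k S) := by
      have h2 : toConv (Bialgebra.counitAlgHom k S) = 1 := by
        apply ofConv_injective
        ext
        simp [AlgHom.convOne_def]
      rw [h2, one_mul]
    rw [h1, hπ.2] at h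
    refine Eq.trans ?_ h
    generalize Coalgebra.comul (R := k) y = z
    induction z with
    | zero => simp
    | add x y hx hy => simp only [map_add, hx, hy]
    | tmul x y => simp [e]
  have he : e = 1 := by
    rw [← one_mul e, ← pointInv_mul e, mul_assoc, hee, pointInv_mul]
  have h : e.ofConv x = (1 : WithConv (R →ₐ[k] k)).ofConv x := by rw [he]
  simpa [e, AlgHom.convOne_def] using h

/-- The right translation action of the subgroup `Spec S` on functions on `Spec R`. -/
noncomputable def translation (π : R →ₐ[k] S) : R →ₐ[k] R ⊗[k] S :=
  (Algebra.TensorProduct.map (AlgHom.id k R) π).comp (Bialgebra.comulAlgHom k R)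

theorem translation_apply (x : R) :
    translation π x = π.toLinearMap.lTensor R (Coalgebra.comul (R := k) x) := rfl

theorem IsHopfQuotient.isComodule (hπ : IsHopfQuotient π) :
    IsComodule (translation π).toLinearMap where
  coassoc x := by
    change TensorProduct.assoc k R S S ((translation π).toLinearMap.rTensor S
      (π.toLinearMap.lTensor R (Coalgebra.comul (R := k) x))) =
      (Coalgebra.comul (R := k) (A := S)).lTensor R (π.toLinearMap.lTensor R (Coalgebra.comul (R := k) x))
    have h1 (y : R ⊗[k] R) : (Coalgebra.comul (R := k) (A := S)).lTensor R
        (π.toLinearMap.lTensor R y) =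
        (TensorProduct.map π.toLinearMap π.toLinearMap).lTensor R
          ((Coalgebra.comul (R := k) (A := R)).lTensor R y) := by
      induction y with
      | zero => simp
      | add x y hx hy => simp only [map_add, hx, hy]
      | tmul x y => simp [hπ.2]
    have h3 (y : (R ⊗[k] R) ⊗[k] R) : TensorProduct.assoc k R S S
        (TensorProduct.map (π.toLinearMap.lTensor R) π.toLinearMap y) =
        (TensorProduct.map π.toLinearMap π.toLinearMap).lTensor R (TensorProduct.assoc k R R R y) := by
      induction y with
      | zero => simp
      | add x y hx hy => simp only [map_add, hx, hy]
      | tmul x y =>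
        induction x with
        | zero => simp
        | add x y hx hy => simp only [TensorProduct.add_tmul, map_add, hx, hy]
        | tmul x z => simp
    have h2 (y : R ⊗[k] R) : (translation π).toLinearMap.rTensor S (π.toLinearMap.lTensor R y) =
        TensorProduct.map (π.toLinearMap.lTensor R) π.toLinearMap
          ((Coalgebra.comul (R := k) (A := R)).rTensor R y) := by
      induction y with
      | zero => simp
      | add x y hx hy => simp only [map_add, hx, hy]
      | tmul x y => simp [translation_apply]
    rw [h1, ← Coalgebra.coassoc_apply, ← h3, h2]
  counit x := by
    have h (y : R ⊗[k] R) : (Coalgebra.counit (R := k) (A := S)).lTensor R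
        (π.toLinearMap.lTensor R y) = (Coalgebra.counit (R := k) (A := R)).lTensor R y := by
      induction y with
      | zero => simp
      | add x y hx hy => simp only [map_add, hx, hy]
      | tmul x y => simp [hπ.counit_apply]
    change TensorProduct.rid k R ((Coalgebra.counit (R := k) (A := S)).lTensor R
        (π.toLinearMap.lTensor R (Coalgebra.comul (R := k) x))) = x
    rw [h]
    simp

/-- The matrix of the contragredient representation. -/
noncomputable def dualMatrix (k : Type) [Field k] {S : Type} [CommRing S] [HopfAlgebra k S]
    (t : Matrix (Fin n) (Fin n) S) : Matrix (Fin n) (Fin n) S :=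
  (t.map (HopfAlgebra.antipodeAlgHom k S))ᵀ

theorem IsMultiplicative.mul_dualMatrix {t : Matrix (Fin n) (Fin n) S} (ht : IsMultiplicative k t) :
    t * (dualMatrix k t)ᵀ = 1 := by
  have h := ht.map_mul_pointInv (toConv (AlgHom.id k S))
  exact h

theorem IsMultiplicative.dual {t : Matrix (Fin n) (Fin n) S} (ht : IsMultiplicative k t) :
    IsMultiplicative k (dualMatrix k t) where
  comul i j := by
    let Δ : WithConv (S →ₐ[k] S ⊗[k] S) := toConv (Bialgebra.comulAlgHom k S)
    let ι₁ : WithConv (S →ₐ[k] S ⊗[k] S) := toConv Algebra.TensorProduct.includeLeft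
    let ι₂ : WithConv (S →ₐ[k] S ⊗[k] S) := toConv Algebra.TensorProduct.includeRight
    have hΔ : Δ = ι₁ * ι₂ := by
      have h := toConv_includeLeft_mul (AlgHom.id k S)
      rw [Algebra.TensorProduct.map_id] at h
      exact h.symm
    have hinv : pointInv Δ = pointInv ι₂ * pointInv ι₁ := by
      have h : pointInv ι₂ * pointInv ι₁ * Δ = 1 := by
        rw [hΔ, mul_assoc, ← mul_assoc (pointInv ι₁), pointInv_mul, one_mul, pointInv_mul]
      rw [← mul_one (_ * _), ← mul_pointInv Δ, ← mul_assoc, h, one_mul]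
    have h := congrFun (congrFun (ht.map_mul (pointInv ι₂) (pointInv ι₁)) j) i
    rw [← hinv] at h
    refine h.trans ?_
    rw [Matrix.mul_apply]
    refine Finset.sum_congr rfl fun l _ => ?_
    change (1 ⊗ₜ[k] _) * (_ ⊗ₜ[k] 1) = _
    rw [Algebra.TensorProduct.tmul_mul_tmul, one_mul, mul_one]
    rfl
  counit i j := by
    have h := DFunLike.congr_fun (AlgHom.counitAlgHom_comp_antipodeAlgHom (R := k) (A := S)) (t j i)
    refine h.trans ((ht.counit j i).trans ?_)
    simp [Matrix.one_apply, eq_comm]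

theorem coactPoly_coactionOfMatrix_X (a : Matrix (Fin n) (Fin n) S) (i : Fin n) :
    coactPoly (coactionOfMatrix (k := k) a) (MvPolynomial.X i) =
      ∑ j, MvPolynomial.X j ⊗ₜ[k] a i j := by
  have h := repMatrix_coactionOfMatrix (k := k) a
  simp only [coactPoly, MvPolynomial.aeval_X]
  exact Finset.sum_congr rfl fun j _ => congrArg _ (congrFun (congrFun h i) j)

end Reductivity

section GeometricReductivity

open WithConv Matrix

variable {k : Type} [Field k] {R : Type} [CommRing R] [HopfAlgebra k R]
  {S : Type} [CommRing S] [HopfAlgebra k S] {π : R →ₐ[k] S} {N m : ℕ}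

/-- Substitution of the linear forms given by the rows of `u` into a polynomial. -/
noncomputable def substForms (u : Fin N → Fin m → R) :
    MvPolynomial (Fin N) k →ₐ[k] MvPolynomial (Fin m) R :=
  MvPolynomial.aeval fun j => ∑ i, MvPolynomial.C (u j i) * MvPolynomial.X i

theorem coeff_substForms_mem_invariantSubalgebra {t : Fin N → Fin N → S}
    (ht : IsMultiplicative k (n := N) t) {u : Fin N → Fin m → R}
    (hu : ∀ i j, translation π (u j i) = ∑ l, u l i ⊗ₜ t l j) {F : MvPolynomial (Fin N) k}
    (hF : coactPoly (coactionOfMatrix (k := k) (dualMatrix k t)) F = F ⊗ₜ 1) (e : Fin m →₀ ℕ) :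
    (substForms u F).coeff e ∈ invariantSubalgebra π := by
  let E (j : Fin N) : MvPolynomial (Fin m) (R ⊗[k] S) :=
    ∑ i, MvPolynomial.C (u j i ⊗ₜ 1) * MvPolynomial.X i
  let c : S →ₐ[k] MvPolynomial (Fin m) (R ⊗[k] S) :=
    (IsScalarTower.toAlgHom k (R ⊗[k] S) (MvPolynomial (Fin m) (R ⊗[k] S))).comp
      Algebra.TensorProduct.includeRight
  have hc (s : S) : c s = MvPolynomial.C (1 ⊗ₜ s) := rfl
  let E' (j : Fin N) : MvPolynomial (Fin m) (R ⊗[k] S) := ∑ l, E l * c (t l j)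
  let Φ : MvPolynomial (Fin N) k ⊗[k] S →ₐ[k] MvPolynomial (Fin m) (R ⊗[k] S) :=
    Algebra.TensorProduct.lift (MvPolynomial.aeval E') c (fun _ _ => .all ..)
  obtain ⟨a, ha⟩ : ∃ a : Fin N → Fin N → S, dualMatrix k t = a := ⟨_, rfl⟩
  have h1 : Φ.comp (coactPoly (coactionOfMatrix (k := k) (dualMatrix k t))) = MvPolynomial.aeval E := by
    refine MvPolynomial.algHom_ext fun i => ?_
    have h (l : Fin N) : ∑ j, c (t l j) * c (a i j) = if l = i then 1 else 0 := by
      have h0 := congrFun (congrFun ht.mul_dualMatrix l) i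
      change ∑ j, t l j * dualMatrix k t i j = _ at h0
      rw [Matrix.one_apply, ha] at h0
      simp only [← map_mul, ← map_sum]
      refine (congrArg c h0).trans ?_
      split_ifs <;> simp
    rw [AlgHom.comp_apply, coactPoly_coactionOfMatrix_X, map_sum, ha]
    simp only [Φ, E', Algebra.TensorProduct.lift_tmul, MvPolynomial.aeval_X, Finset.sum_mul]
    rw [Finset.sum_comm]
    simp only [mul_assoc, ← Finset.mul_sum, h]
    simp
  have h2 : MvPolynomial.aeval E F = MvPolynomial.aeval E' F := by
    rw [← h1, AlgHom.comp_apply, hF]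
    simp [Φ]
  have h3 : (MvPolynomial.mapAlgHom (Algebra.TensorProduct.includeLeft : R →ₐ[k] R ⊗[k] S)).comp
      (substForms u) = MvPolynomial.aeval E := by
    refine MvPolynomial.algHom_ext fun i => ?_
    simp [substForms, E]
  have h4 : (MvPolynomial.mapAlgHom (translation π)).comp
      (substForms u) = MvPolynomial.aeval E' := by
    refine MvPolynomial.algHom_ext fun j => ?_
    simp only [substForms, AlgHom.comp_apply, MvPolynomial.aeval_X, map_sum, map_mul, E', E,
      MvPolynomial.mapAlgHom_apply, MvPolynomial.map_C, MvPolynomial.map_X, Finset.sum_mul]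
    rw [Finset.sum_comm]
    refine Finset.sum_congr rfl fun i _ => ?_
    change MvPolynomial.C (translation π (u j i)) * _ = _
    rw [hu, map_sum, Finset.sum_mul]
    refine Finset.sum_congr rfl fun l _ => ?_
    rw [hc, mul_right_comm, ← map_mul, Algebra.TensorProduct.tmul_mul_tmul, one_mul, mul_one]
  have h5 := DFunLike.congr_fun h4 F
  rw [← h2, ← h3] at h5
  have h6 := congrArg (MvPolynomial.coeff e) h5
  simp only [AlgHom.comp_apply, MvPolynomial.mapAlgHom_apply, MvPolynomial.coeff_map] at h6
  exact h6

theorem mem_of_eval_mem {B : Type} [CommRing B] {I : Ideal B} {G : MvPolynomial (Fin m) B}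
    (hG : MvPolynomial.constantCoeff G = 0) {x : Fin m → B} (hx : ∀ i, x i ∈ I) :
    MvPolynomial.eval x G ∈ I := by
  rw [← Ideal.Quotient.eq_zero_iff_mem, ← MvPolynomial.eval₂_id, MvPolynomial.hom_eval₂]
  have h : (fun i => Ideal.Quotient.mk I (x i)) = 0 :=
    funext fun i => Ideal.Quotient.eq_zero_iff_mem.mpr (hx i)
  change MvPolynomial.eval₂ _ (fun i => Ideal.Quotient.mk I (x i)) G = 0
  rw [h, MvPolynomial.eval₂_zero_apply, hG, map_zero]

theorem MvPolynomial.IsHomogeneous.aeval_smul {F : MvPolynomial (Fin N) k} {d : ℕ}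
    (hF : F.IsHomogeneous d) (lam : Fin N → k) (f : R) :
    MvPolynomial.aeval (fun j => lam j • f) F = MvPolynomial.eval lam F • f ^ d := by
  rw [MvPolynomial.aeval_def, MvPolynomial.eval₂_eq', MvPolynomial.eval_eq', Finset.sum_smul]
  refine Finset.sum_congr rfl fun e he => ?_
  have hd : ∑ i, e i = d := by
    rw [← hF (MvPolynomial.mem_support_iff.mp he)]
    simp [Finsupp.weight_apply, Finsupp.sum_fintype]
  simp only [smul_pow, Finset.prod_smul, Finset.prod_pow_eq_pow_sum, hd]
  rw [mul_smul, Algebra.smul_def (MvPolynomial.coeff e F)]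

theorem MvPolynomial.IsHomogeneous.constantCoeff_eq_zero {F : MvPolynomial (Fin N) k} {d : ℕ}
    (hF : F.IsHomogeneous d) (hd : 0 < d) : MvPolynomial.constantCoeff F = 0 := by
  by_contra h
  have := hF h
  simp at this
  omega

theorem constantCoeff_substForms (u : Fin N → Fin m → R) (F : MvPolynomial (Fin N) k) :
    MvPolynomial.constantCoeff (substForms u F) =
      algebraMap k R (MvPolynomial.constantCoeff F) := by
  induction F using MvPolynomial.induction_on with
  | C a => simp [substForms, MvPolynomial.algebraMap_apply]
  | add p q hp hq => simp only [map_add, hp, hq]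
  | mul_X p i hp => simp [substForms]

theorem eval_substForms (u : Fin N → Fin m → R) (y : Fin m → R) (F : MvPolynomial (Fin N) k) :
    MvPolynomial.eval y (substForms u F) = MvPolynomial.aeval (fun j => ∑ i, y i * u j i) F := by
  induction F using MvPolynomial.induction_on with
  | C a => simp [substForms, MvPolynomial.algebraMap_apply]
  | add p q hp hq => simp only [map_add, hp, hq]
  | mul_X p i hp => simp only [map_mul, hp]; simp [substForms, mul_comm]

theorem IsReductive.mem_of_eq_sum (hS : IsReductive k S) (hπ : IsHopfQuotient π)
    {I : Ideal (invariantSubalgebra π)} (hI : I.IsPrime) {x : Fin m → invariantSubalgebra π}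
    (hx : ∀ i, x i ∈ I) {r : Fin m → R} {f : invariantSubalgebra π}
    (hf : (f : R) = ∑ i, x i * r i) : f ∈ I := by
  by_cases hf0 : (f : R) = 0
  · rw [show f = 0 from Subtype.ext hf0]; exact I.zero_mem
  obtain ⟨N, t, ξ, c, ht, hr, hu⟩ := hπ.isComodule.exists_matrix r
  let u : Fin N → Fin m → R := fun j i => rightSlice R (ξ j) (translation π (r i))
  let lam : Fin N → k := fun j => ξ j 1
  have hslice (ζ : S →ₗ[k] k) (b : R) (y : R ⊗[k] S) :
      rightSlice R ζ ((b ⊗ₜ 1) * y) = b * rightSlice R ζ y := by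
    induction y with
    | zero => simp
    | add x y hx hy => simp only [map_add, mul_add, hx, hy]
    | tmul x y => simp
  have htr (b : invariantSubalgebra π) : translation π b = (b : R) ⊗ₜ 1 := b.2
  have hxu (j) : ∑ i, x i * u j i = lam j • (f : R) := by
    have h := congrArg (rightSlice R (ξ j)) (htr f)
    rw [hf] at h
    simp only [map_sum, map_mul, htr, hslice, rightSlice_tmul] at h
    rw [hf]
    exact h
  have hlam : lam ≠ 0 := by
    intro h0
    apply hf0
    rw [hf]
    have : ∀ i, (x i : R) * r i = ∑ j, c j • (x i * u j i) := by
      intro i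
      conv_lhs => rw [hr i]
      rw [Finset.mul_sum]
      exact Finset.sum_congr rfl fun j _ => mul_smul_comm ..
    rw [Finset.sum_congr rfl fun i _ => this i, Finset.sum_comm]
    refine Finset.sum_eq_zero fun j _ => ?_
    rw [← Finset.smul_sum, hxu, h0]
    simp
  have hlamt (j) : ∑ l, lam l • t l j = lam j • 1 := by
    have h := congrArg (translation π) (hxu j)
    rw [map_sum, map_smul, htr] at h
    have h1 (i) : translation π (x i * u j i) = ∑ l, ((x i : R) * u l i) ⊗ₜ t l j := by
      rw [map_mul, htr, show translation π (u j i) = _ from hu i j, Finset.mul_sum]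
      simp only [Algebra.TensorProduct.tmul_mul_tmul, one_mul]
      rfl
    rw [Finset.sum_congr rfl fun i _ => h1 i, Finset.sum_comm] at h
    simp only [← TensorProduct.sum_tmul, hxu, TensorProduct.smul_tmul,
      ← TensorProduct.tmul_sum] at h
    obtain ⟨ζ, hζ⟩ : ∃ ζ : Module.Dual k R, ζ f ≠ 0 := by
      by_contra! h0
      exact hf0 ((Module.forall_dual_apply_eq_zero_iff k _).mp h0)
    have h2 := congrArg (fun y => TensorProduct.lid k S (ζ.rTensor S y)) h
    refine smul_right_injective S hζ ?_
    simpa [smul_comm (lam j), Finset.smul_sum] using h2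
  have hinv : coactionOfMatrix (dualMatrix k t) lam = lam ⊗ₜ (1 : S) := by
    obtain ⟨a, ha⟩ : ∃ a : Fin N → Fin N → S, dualMatrix k t = a := ⟨_, rfl⟩
    have hta (l i : Fin N) : ∑ j, t l j * a i j = if l = i then 1 else 0 := by
      rw [← ha, ← Matrix.one_apply, ← ht.mul_dualMatrix]
      rfl
    have h (i : Fin N) : ∑ j, lam j • a i j = lam i • 1 := by
      have h1 (j : Fin N) : lam j • a i j = ∑ l, lam l • (t l j * a i j) := by
        rw [← one_mul (a i j), ← smul_mul_assoc, ← hlamt, Finset.sum_mul]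
        simp
      simp only [h1]
      rw [Finset.sum_comm]
      simp [← Finset.smul_sum, hta]
    rw [coactionOfMatrix_apply, ha]
    simp only [h, ← TensorProduct.smul_tmul, ← TensorProduct.sum_tmul]
    congr 1
    ext i
    simp [Finset.sum_apply, Pi.single_apply]
  obtain ⟨F, d, hd, hhom, hFinv, hFlam⟩ := hS.2.2 N _ ht.dual.isCoaction lam hlam hinv
  have hcoeff := coeff_substForms_mem_invariantSubalgebra (π := π) ht (u := u) (fun i j => hu i j) hFinv
  obtain ⟨G, hG⟩ : ∃ G : MvPolynomial (Fin m) (invariantSubalgebra π),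
      MvPolynomial.map (invariantSubalgebra π).val.toRingHom G = substForms u F := by
    refine MvPolynomial.mem_range_map_iff_coeffs_subset.mpr fun y hy => ?_
    obtain ⟨e, -, rfl⟩ := MvPolynomial.mem_coeffs_iff.mp hy
    exact ⟨⟨_, hcoeff e⟩, rfl⟩
  have h0 : MvPolynomial.constantCoeff G = 0 := by
    apply Subtype.val_injective
    have h := constantCoeff_substForms u F
    rw [← hG, hhom.constantCoeff_eq_zero hd, map_zero, MvPolynomial.constantCoeff_map] at h
    exact h
  have heval : MvPolynomial.eval x G = MvPolynomial.eval lam F • f ^ d := by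
    apply Subtype.val_injective
    have h := eval_substForms u (fun i => (x i : R)) F
    simp only [hxu] at h
    rw [hhom.aeval_smul, ← hG, MvPolynomial.eval_map] at h
    rw [← MvPolynomial.eval₂_id]
    exact (MvPolynomial.hom_eval₂ _ _ (invariantSubalgebra π).val.toRingHom _).trans h
  have hmem := mem_of_eval_mem h0 hx
  rw [heval] at hmem
  have := Submodule.smul_mem I (algebraMap k (invariantSubalgebra π) (MvPolynomial.eval lam F)⁻¹) hmem
  rw [algebraMap_smul, smul_smul, inv_mul_cancel₀ hFlam, one_smul] at this
  exact hI.mem_of_pow_mem d this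

end GeometricReductivity

/-! ### Affineness of the orbit -/

section OpenImmersion

theorem comap_injective_of_forall_exists_pow_mul_eq {A B : Type} [CommRing A] [CommRing B]
    {φ : A →+* B} (h : ∀ P : PrimeSpectrum B, ∃ f, φ f ∉ P.asIdeal ∧
      ∀ b, ∃ (m : ℕ) (a : A), φ f ^ m * b = φ a) :
    Function.Injective (PrimeSpectrum.comap φ) := by
  intro P Q hPQ
  obtain ⟨f, hf, hf'⟩ := h P
  have hcomap (a : A) : φ a ∈ P.asIdeal ↔ φ a ∈ Q.asIdeal := by
    change a ∈ (PrimeSpectrum.comap φ P).asIdeal ↔ a ∈ (PrimeSpectrum.comap φ Q).asIdeal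
    rw [hPQ]
  ext b
  obtain ⟨m, a, hab⟩ := hf' b
  have hmem {P' : Ideal B} (hP' : P'.IsPrime) (hfP' : φ f ∉ P') : b ∈ P' ↔ φ a ∈ P' := by
    rw [← hab]
    exact ⟨P'.mul_mem_left _, fun hb => (hP'.mem_or_mem hb).resolve_left
      fun hm => hfP' (hP'.mem_of_pow_mem m hm)⟩
  exact (hmem P.2 hf).trans ((hcomap a).trans (hmem Q.2 ((hcomap f).not.mp hf)).symm)

theorem isOpenImmersion_SpecMap_of_forall_exists_pow_mul_eq {A B : Type} [CommRing A]
    [CommRing B] {φ : A →+* B} (hφ : Function.Injective φ)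
    (h : ∀ P : PrimeSpectrum B, ∃ f, φ f ∉ P.asIdeal ∧
      ∀ b, ∃ (m : ℕ) (a : A), φ f ^ m * b = φ a) :
    IsOpenImmersion (Spec.map (CommRingCat.ofHom φ)) := by
  refine .of_forall_source_exists _ (comap_injective_of_forall_exists_pow_mul_eq h) fun P => ?_
  obtain ⟨f, hf, hf'⟩ := h P
  refine ⟨_, Spec.map (CommRingCat.ofHom (algebraMap B (Localization.Away (φ f)))),
    .of_isLocalization (φ f), ?_, ?_⟩
  · change P ∈ Set.range (PrimeSpectrum.comap (algebraMap B (Localization.Away (φ f))))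
    rw [PrimeSpectrum.localization_away_comap_range _ (φ f)]
    exact hf
  · rw [← Spec.map_comp, ← CommRingCat.ofHom_comp]
    let := ((algebraMap B (Localization.Away (φ f))).comp φ).toAlgebra
    have halg (a : A) : algebraMap A (Localization.Away (φ f)) a =
      algebraMap B (Localization.Away (φ f)) (φ a) := rfl
    have : IsLocalization.Away f (Localization.Away (φ f)) := by
      refine ⟨?_, fun z => ?_, fun {x y} hxy => ?_⟩
      · rintro ⟨_, m, rfl⟩
        simp only [map_pow, halg]
        exact (IsLocalization.Away.algebraMap_isUnit (φ f)).pow m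
      · obtain ⟨⟨b, _, l, rfl⟩, hb⟩ := IsLocalization.surj (Submonoid.powers (φ f)) z
        obtain ⟨m, a, hab⟩ := hf' b
        refine ⟨⟨a, f ^ (m + l), m + l, rfl⟩, ?_⟩
        rw [halg, halg, ← hab, map_mul, ← hb]
        simp only [map_pow]
        ring
      · rw [halg, halg, IsLocalization.eq_iff_exists (Submonoid.powers (φ f))] at hxy
        obtain ⟨⟨_, m, rfl⟩, hm⟩ := hxy
        refine ⟨⟨f ^ m, m, rfl⟩, hφ ?_⟩
        simpa using hm
    exact .of_isLocalization f

end OpenImmersion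

section OrbitQuotient

variable {k : Type} [Field k] {R : Type} [CommRing R] [HopfAlgebra k R]
  {S : Type} [CommRing S] [HopfAlgebra k S] {π : R →ₐ[k] S} {n : ℕ}
  {ρ : (Fin n → k) →ₗ[k] (Fin n → k) ⊗[k] R} {w : Fin n → k}

theorem IsReductive.comap_val_surjective (hS : IsReductive k S) (hπ : IsHopfQuotient π) :
    Function.Surjective (PrimeSpectrum.comap (invariantSubalgebra π).val.toRingHom) := by
  intro P
  rw [← Set.mem_range, PrimeSpectrum.mem_range_comap_iff]
  refine le_antisymm (fun f hf => ?_) Ideal.le_comap_map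
  rw [Ideal.mem_comap, Ideal.map, Ideal.span, Submodule.mem_span_set'] at hf
  obtain ⟨m, r, y, hy⟩ := hf
  choose x hx hxy using fun i => (y i).2
  refine hS.mem_of_eq_sum hπ P.2 hx (r := r) (hy.symm.trans ?_)
  refine Finset.sum_congr rfl fun i _ => ?_
  rw [← hxy, smul_eq_mul, mul_comm]
  rfl

/-- The comorphism of the map `G/G_w → V` induced by the orbit map of `w`. -/
noncomputable def quotientOrbitHom (hρ : IsCoaction ρ)
    (hker : RingHom.ker π.toRingHom = stabIdeal ρ w) :
    MvPolynomial (Fin n) k →ₐ[k] invariantSubalgebra π :=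
  (orbitHom ρ w).codRestrict _ (orbitHom_mem_invariantSubalgebra hρ hker)

theorem range_comap_quotientOrbitHom (hρ : IsCoaction ρ) (hπ : IsHopfQuotient π)
    (hker : RingHom.ker π.toRingHom = stabIdeal ρ w) (hS : IsReductive k S) :
    Set.range (PrimeSpectrum.comap (quotientOrbitHom hρ hker).toRingHom) =
      Set.range (PrimeSpectrum.comap (orbitHom ρ w).toRingHom) :=
  ((hS.comap_val_surjective hπ).range_comp _).symm

theorem isOpenImmersion_SpecMap_quotientOrbitHom (hρ : IsCoaction ρ) (hπ : IsHopfQuotient π)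
    (hker : RingHom.ker π.toRingHom = stabIdeal ρ w) (hS : IsReductive k S)
    (hU : IsOpen (Set.range (PrimeSpectrum.comap (orbitHom ρ w).toRingHom))) :
    IsOpenImmersion (Spec.map (CommRingCat.ofHom (quotientOrbitHom hρ hker).toRingHom)) := by
  have hinj := orbitHom_injective hU
  refine isOpenImmersion_SpecMap_of_forall_exists_pow_mul_eq
    (fun _ _ h => hinj (congrArg Subtype.val h)) fun P => ?_
  have hP := (range_comap_quotientOrbitHom hρ hπ hker hS).le ⟨P, rfl⟩
  obtain ⟨_, ⟨f, rfl⟩, hf, hfU⟩ :=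
    PrimeSpectrum.isTopologicalBasis_basic_opens.exists_subset_of_mem_open hP hU
  refine ⟨f, hf, fun b => ?_⟩
  obtain ⟨m, p, h⟩ := exists_pow_mul_eq_orbitHom hρ hπ.1 hker (flat_orbitHom hρ hinj) hfU b.2
  exact ⟨m, p, Subtype.ext h⟩

end OrbitQuotient

theorem open_orbit_affine_iso_quotient
    (k : Type) [Field k] (R : Type) [CommRing R] [HopfAlgebra k R]
    (hG : IsReductive k R)
    (n : ℕ) (ρ : (Fin n → k) →ₗ[k] (Fin n → k) ⊗[k] R) (hρ : IsCoaction ρ)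
    (w : Fin n → k)
    (hU : IsOpen (Set.range (orbitMap ρ w).base))
    (S : Type) [CommRing S] [HopfAlgebra k S] (π : R →ₐ[k] S)
    (hπ : IsHopfQuotient π) (hker : RingHom.ker π.toRingHom = stabIdeal ρ w)
    (hstab : IsReductive k S) :
    IsAffineOpen (⟨Set.range (orbitMap ρ w).base, hU⟩ :
        (Spec (CommRingCat.of (MvPolynomial (Fin n) k))).Opens) ∧
      Nonempty ((Spec (CommRingCat.of (invariantSubalgebra π))) ≅
        Scheme.Opens.toScheme (⟨Set.range (orbitMap ρ w).base, hU⟩ :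
          (Spec (CommRingCat.of (MvPolynomial (Fin n) k))).Opens)) := by
  have := isOpenImmersion_SpecMap_quotientOrbitHom hρ hπ hker hstab hU
  let U : (Spec (CommRingCat.of (MvPolynomial (Fin n) k))).Opens :=
    ⟨Set.range (orbitMap ρ w).base, hU⟩
  have e : Spec (CommRingCat.of (invariantSubalgebra π)) ≅ U :=
    IsOpenImmersion.isoOfRangeEq
      (Spec.map (CommRingCat.ofHom (quotientOrbitHom hρ hker).toRingHom)) U.ι <|
      (range_comap_quotientOrbitHom hρ hπ hker hstab).trans U.range_ι.symm
  exact ⟨.of_isIso e.inv, ⟨e⟩⟩
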